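/- arXiv:1612.03080 — 7 statements merged into one kernel-verified Lean document; each statement's English description precedes it below -/
import Mathlib

section
/- Let n ≥ 1, y ∈ ℝ^{ZMod n} and λ > 0. The constant vector ȳ𝟙 (where ȳ is the mean of y) is the minimizer of x ↦ (1/2)‖y − x‖₂² + λ‖∇x‖₁ over ℝ^{ZMod n} if and only if there exists v ∈ ℝ^{ZMod n} with ‖v‖_∞ ≤ λ and div v = y − ȳ𝟙. -/
/-- Discrete periodic divergence in 1D: `(div v) i = v (i-1) - v i`. -/
noncomputable def div1 (n : ℕ) (v : ZMod n → ℝ) : ZMod n → ℝ :=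
  fun i => v (i - 1) - v i

/-- Mean of a vector indexed by `ZMod n`. -/
noncomputable def mean1 (n : ℕ) [NeZero n] (y : ZMod n → ℝ) : ℝ :=
  (∑ i, y i) / n

/-- Sup norm of a vector indexed by `ZMod n`. -/
noncomputable def normInf1 (n : ℕ) [NeZero n] (v : ZMod n → ℝ) : ℝ :=
  Finset.univ.sup' Finset.univ_nonempty fun i => |v i|

/-- TV-denoising objective: `(1/2)‖y - x‖₂² + λ‖∇x‖₁`. -/
noncomputable def obj1 (n : ℕ) [NeZero n] (lam : ℝ) (y x : ZMod n → ℝ) : ℝ :=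
  (1 / 2) * ∑ i, (y i - x i) ^ 2 + lam * ∑ i, |x (i + 1) - x i|

theorem exists_grad1 (n : ℕ) [NeZero n] (h : ZMod n → ℝ) (hs : ∑ i, h i = 0) :
    ∃ d : ZMod n → ℝ, ∀ i, d (i + 1) - d i = h i := by
  have hpos : 0 < n := Nat.pos_of_ne_zero (NeZero.ne n)
  have hsum : ∑ k ∈ Finset.range n, h (k : ZMod n) = 0 := by
    rw [← hs]
    refine Finset.sum_bij' (fun k _ => (k : ZMod n)) (fun i _ => i.val) ?_ ?_ ?_ ?_ ?_
    · intros; simp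
    · intro i _; simpa using ZMod.val_lt i
    · intro k hk; exact ZMod.val_cast_of_lt (Finset.mem_range.1 hk)
    · intro i _; exact ZMod.natCast_zmod_val i
    · intros; rfl
  refine ⟨fun i => ∑ k ∈ Finset.range i.val, h (k : ZMod n), fun i => ?_⟩
  have hi : ((i.val : ℕ) : ZMod n) = i := ZMod.natCast_zmod_val i
  have hlt := ZMod.val_lt i
  have hi1 : i + 1 = ((i.val + 1 : ℕ) : ZMod n) := by push_cast; rw [hi]
  rcases lt_or_eq_of_le (Nat.succ_le_of_lt hlt) with h1 | h1
  · have : (i + 1).val = i.val + 1 := by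
      rw [hi1]; exact ZMod.val_cast_of_lt h1
    simp only [this, Finset.sum_range_succ, hi]
    ring
  · have h2 : i.val + 1 = n := h1
    have : (i + 1).val = 0 := by
      rw [hi1, h2]; simp
    have h3 : ∑ k ∈ Finset.range (i.val + 1), h (k : ZMod n) = 0 := by rw [h2, hsum]
    rw [Finset.sum_range_succ, hi] at h3
    simp only [this, Finset.range_zero, Finset.sum_empty]
    linarith

theorem sum_shift1 (n : ℕ) [NeZero n] (f : ZMod n → ℝ) :
    ∑ i, f (i + 1) = ∑ i, f i :=
  Equiv.sum_comp (Equiv.addRight (1 : ZMod n)) f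

theorem sum_parts1 (n : ℕ) [NeZero n] (v d : ZMod n → ℝ) :
    ∑ i, (v (i - 1) - v i) * d i = ∑ i, v i * (d (i + 1) - d i) := by
  have h := sum_shift1 n (fun i => v (i - 1) * d i)
  simp only [add_sub_cancel_right] at h
  simp only [sub_mul, mul_sub, Finset.sum_sub_distrib]
  rw [h]

theorem obj_diff1 (n : ℕ) [NeZero n] (lam m : ℝ) (y d : ZMod n → ℝ) :
    obj1 n lam y (fun i => m + d i) - obj1 n lam y (fun _ => m) =
      (1 / 2) * ∑ i, d i ^ 2 - ∑ i, (y i - m) * d i + lam * ∑ i, |d (i + 1) - d i| := by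
  have e : ∑ i, (y i - (m + d i)) ^ 2 =
      ∑ i, (y i - m) ^ 2 - 2 * ∑ i, (y i - m) * d i + ∑ i, d i ^ 2 := by
    rw [Finset.mul_sum, ← Finset.sum_sub_distrib, ← Finset.sum_add_distrib]
    exact Finset.sum_congr rfl fun i _ => by ring
  simp only [obj1, e, add_sub_add_left_eq_sub, sub_self, abs_zero, Finset.sum_const_zero]
  ring

theorem stmt0 (n : ℕ) [NeZero n] (hn : 1 ≤ n) (y : ZMod n → ℝ) (lam : ℝ)
    (hlam : 0 < lam) :
    (∀ x : ZMod n → ℝ, obj1 n lam y (fun _ => mean1 n y) ≤ obj1 n lam y x) ↔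
      ∃ v : ZMod n → ℝ, normInf1 n v ≤ lam ∧
        div1 n v = fun i => y i - mean1 n y := by
  have hg : ∑ i, (y i - mean1 n y) = 0 := by
    have : (n : ℝ) ≠ 0 := Nat.cast_ne_zero.2 (NeZero.ne n)
    simp only [Finset.sum_sub_distrib, Finset.sum_const, Finset.card_univ, ZMod.card,
      nsmul_eq_mul, mean1]
    field_simp
    ring
  generalize mean1 n y = m at hg ⊢
  constructor
  · intro H
    have key : ∀ d : ZMod n → ℝ,
        ∑ i, (y i - m) * d i ≤ lam * ∑ i, |d (i + 1) - d i| := by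
      intro d
      have S0 : 0 ≤ ∑ i, d i ^ 2 := Finset.sum_nonneg fun i _ => sq_nonneg _
      refine le_of_forall_pos_le_add fun ε hε => ?_
      set S := ∑ i, d i ^ 2 with hS
      set t : ℝ := ε / (S + 1) with ht
      have tpos : 0 < t := by positivity
      have h := obj_diff1 n lam m y (fun i => t * d i)
      have h0 := H (fun i => m + t * d i)
      have e1 : ∑ i, (t * d i) ^ 2 = t ^ 2 * S := by
        rw [hS, Finset.mul_sum]; exact Finset.sum_congr rfl fun i _ => by ring
      have e2 : ∑ i, (y i - m) * (t * d i) = t * ∑ i, (y i - m) * d i := by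
        rw [Finset.mul_sum]; exact Finset.sum_congr rfl fun i _ => by ring
      have e3 : ∑ i, |t * d (i + 1) - t * d i| = t * ∑ i, |d (i + 1) - d i| := by
        rw [Finset.mul_sum]
        exact Finset.sum_congr rfl fun i _ => by
          rw [← mul_sub, abs_mul, abs_of_pos tpos]
      rw [e1, e2, e3] at h
      have h4 : 0 ≤ t * ((1 / 2) * (t * S) - ∑ i, (y i - m) * d i
          + lam * ∑ i, |d (i + 1) - d i|) := by nlinarith
      have h5 := nonneg_of_mul_nonneg_right h4 tpos
      have h6 : t * (S + 1) = ε := by rw [ht]; field_simp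
      nlinarith
    obtain ⟨w, hw⟩ := exists_grad1 n (fun i => -(y (i + 1) - m)) (by
      rw [sum_shift1 n (fun i => -(y i - m)), Finset.sum_neg_distrib, hg, neg_zero])
    have hw' : ∀ i, w (i - 1) - w i = y i - m := by
      intro i
      have := hw (i - 1)
      simp only [sub_add_cancel] at this
      linarith
    obtain ⟨p, hp⟩ := Finite.exists_max w
    obtain ⟨q, hq⟩ := Finite.exists_min w
    obtain ⟨d, hd⟩ := exists_grad1 n
      (fun i => (if i = p then (1 : ℝ) else 0) - (if i = q then 1 else 0)) (by simp)
    have hk := key d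
    have e1 : ∑ i, (y i - m) * d i = w p - w q := by
      simp only [← hw']
      rw [sum_parts1]
      simp [hd, mul_sub]
    have e2 : ∑ i, |d (i + 1) - d i| ≤ 2 := by
      calc ∑ i, |d (i + 1) - d i|
          ≤ ∑ i, ((if i = p then (1 : ℝ) else 0) + (if i = q then 1 else 0)) := by
            refine Finset.sum_le_sum fun i _ => ?_
            rw [hd]
            split_ifs <;> norm_num
        _ = 2 := by simp [Finset.sum_add_distrib]; norm_num
    have h2 : w p - w q ≤ lam * 2 := by
      rw [e1] at hk
      exact hk.trans (mul_le_mul_of_nonneg_left e2 hlam.le)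
    refine ⟨fun i => w i - (w p + w q) / 2, ?_, ?_⟩
    · refine Finset.sup'_le _ _ fun i _ => ?_
      rw [abs_le]
      constructor <;> linarith [hp i, hq i]
    · funext i
      simp only [div1]
      linarith [hw' i]
  · rintro ⟨v, hv, hdiv⟩ x
    have h := obj_diff1 n lam m y (fun i => x i - m)
    simp only [add_sub_cancel] at h
    have hv' : ∀ i, |v i| ≤ lam := fun i =>
      (Finset.le_sup' (fun i => |v i|) (Finset.mem_univ i)).trans hv
    have e : ∑ i, (y i - m) * (x i - m) ≤ lam * ∑ i, |x (i + 1) - m - (x i - m)| := by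
      have e0 : ∀ i, y i - m = v (i - 1) - v i := fun i => (congrFun hdiv i).symm
      simp only [e0]
      rw [sum_parts1 n v (fun i => x i - m), Finset.mul_sum]
      refine Finset.sum_le_sum fun i _ => ?_
      refine (le_abs_self _).trans ?_
      rw [abs_mul]
      exact mul_le_mul_of_nonneg_right (hv' i) (abs_nonneg _)
    have S0 : 0 ≤ ∑ i, (x i - m) ^ 2 := Finset.sum_nonneg fun i _ => sq_nonneg _
    linarith
end

section
/- Let n ≥ 1 and y ∈ ℝ^{ZMod n}. Define λ_max = sInf {‖v‖_∞ : v ∈ ℝ^{ZMod n}, div v = y − ȳ𝟙}. Then for every λ > 0, the constant vector ȳ𝟙 is the minimizer of x ↦ (1/2)‖y − x‖₂² + λ‖∇x‖₁ if and only if λ ≥ λ_max. -/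
theorem sum_range_zmod (n : ℕ) [NeZero n] (w : ZMod n → ℝ) :
    ∑ k ∈ Finset.range n, w (k : ZMod n) = ∑ i, w i := by
  refine Finset.sum_nbij' (fun k => (k : ZMod n)) (fun i => i.val) ?_ ?_ ?_ ?_ ?_
  · intro k _; simp
  · intro i _; simpa using ZMod.val_lt i
  · intro k hk; exact ZMod.val_cast_of_lt (by simpa using hk)
  · intro i _; simp
  · intro k _; rfl

theorem exists_grad (n : ℕ) [NeZero n] (w : ZMod n → ℝ) (hw : ∑ i, w i = 0) :
    ∃ u : ZMod n → ℝ, ∀ i, u (i + 1) - u i = w i := by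
  let U : ℕ → ℝ := fun m => ∑ k ∈ Finset.range m, w (k : ZMod n)
  have hs : ∀ m, U (m + 1) = U m + w (m : ZMod n) := fun m => Finset.sum_range_succ _ _
  have hper : Function.Periodic U n := by
    intro k
    induction k with
    | zero => simp [U, sum_range_zmod, hw]
    | succ k ih =>
      rw [show k + 1 + n = (k + n) + 1 by ring, hs, hs, ih]; simp
  refine ⟨fun i => U i.val, fun i => ?_⟩
  have h1 : (i + 1).val = (i.val + 1) % n := by
    rw [← ZMod.val_natCast]; simp
  simp only [h1]
  rw [hper.map_mod_nat, hs]; simp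

theorem sum_div1_mul (n : ℕ) [NeZero n] (v x : ZMod n → ℝ) :
    ∑ i, div1 n v i * x i = ∑ i, v i * (x (i + 1) - x i) := by
  have h : ∑ i, v (i - 1) * x i = ∑ i, v i * x (i + 1) := by
    rw [← Equiv.sum_comp (Equiv.addRight (1 : ZMod n))]
    simp
  simp only [div1, sub_mul, mul_sub, Finset.sum_sub_distrib, h]

theorem sum_sub_mean1 (n : ℕ) [NeZero n] (y : ZMod n → ℝ) :
    ∑ i, (y i - mean1 n y) = 0 := by
  have : (n : ℝ) ≠ 0 := by exact_mod_cast NeZero.ne n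
  simp only [Finset.sum_sub_distrib, Finset.sum_const, Finset.card_univ, ZMod.card,
    nsmul_eq_mul, mean1]
  field_simp
  simp

theorem exists_div1 (n : ℕ) [NeZero n] (y : ZMod n → ℝ) :
    ∃ v : ZMod n → ℝ, div1 n v = (fun i => y i - mean1 n y) := by
  obtain ⟨u, hu⟩ := exists_grad n (fun i => y (i + 1) - mean1 n y) (by
    rw [← sum_sub_mean1 n y]
    exact Equiv.sum_comp (Equiv.addRight (1 : ZMod n)) (fun i => y i - mean1 n y))
  refine ⟨fun i => - u i, funext fun i => ?_⟩
  have := hu (i - 1)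
  simp only [sub_add_cancel] at this
  simp only [div1]; linarith

/-- Expansion of the objective around the mean. -/
theorem obj1_expand (n : ℕ) [NeZero n] (lam : ℝ) (y x v : ZMod n → ℝ)
    (hv : div1 n v = (fun i => y i - mean1 n y)) :
    obj1 n lam y (fun i => mean1 n y + x i) = obj1 n lam y (fun _ => mean1 n y)
      + (1 / 2) * ∑ i, x i ^ 2 - ∑ i, v i * (x (i + 1) - x i)
      + lam * ∑ i, |x (i + 1) - x i| := by
  rw [← sum_div1_mul, hv]
  have : ∑ i, (y i - (mean1 n y + x i)) ^ 2 = ∑ i, (y i - mean1 n y) ^ 2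
      + ∑ i, x i ^ 2 - 2 * ∑ i, (y i - mean1 n y) * x i := by
    rw [Finset.mul_sum, ← Finset.sum_add_distrib, ← Finset.sum_sub_distrib]
    exact Finset.sum_congr rfl fun i _ => by ring
  simp only [obj1, this, add_sub_add_left_eq_sub, sub_self, abs_zero, Finset.sum_const_zero]
  ring

theorem stmt1 (n : ℕ) [NeZero n] (hn : 1 ≤ n) (y : ZMod n → ℝ) :
    ∀ lam : ℝ, 0 < lam →
      ((∀ x : ZMod n → ℝ, obj1 n lam y (fun _ => mean1 n y) ≤ obj1 n lam y x) ↔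
        sInf {r : ℝ | ∃ v : ZMod n → ℝ,
          div1 n v = (fun i => y i - mean1 n y) ∧ r = normInf1 n v} ≤ lam) := by
  intro lam hlam
  obtain ⟨v0, hv0⟩ := exists_div1 n y
  constructor
  · intro hmin
    obtain ⟨a, ha⟩ := Finite.exists_max v0
    obtain ⟨b, hb⟩ := Finite.exists_min v0
    have hkey : v0 a - v0 b ≤ 2 * lam := by
      obtain ⟨u, hu⟩ := exists_grad n
        (fun i => (if i = a then 1 else 0) - (if i = b then 1 else 0)) (by simp)
      have hS : 0 ≤ ∑ i, u i ^ 2 := Finset.sum_nonneg fun i _ => sq_nonneg _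
      have hvu : ∑ i, v0 i * (u (i + 1) - u i) = v0 a - v0 b := by
        simp [hu, mul_sub, Finset.sum_sub_distrib]
      have hTV : ∑ i, |u (i + 1) - u i| ≤ 2 := by
        calc ∑ i, |u (i + 1) - u i|
            ≤ ∑ i, ((if i = a then (1 : ℝ) else 0) + (if i = b then 1 else 0)) := by
              refine Finset.sum_le_sum fun i _ => ?_
              rw [hu]
              split_ifs <;> norm_num
          _ = 2 := by simp [Finset.sum_add_distrib]; norm_num
      have hineq : ∀ t : ℝ, 0 < t →
          v0 a - v0 b ≤ 2 * lam + t * ((1 / 2) * ∑ i, u i ^ 2) := by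
        intro t ht
        have h := hmin (fun i => mean1 n y + t * u i)
        rw [obj1_expand n lam y (fun i => t * u i) v0 hv0] at h
        simp only [← mul_sub, abs_mul, abs_of_pos ht, mul_pow, mul_left_comm _ t,
          ← Finset.mul_sum, hvu] at h
        have h2 : lam * ∑ i, |u (i + 1) - u i| ≤ lam * 2 :=
          mul_le_mul_of_nonneg_left hTV hlam.le
        have h3 : 0 ≤ t * (t * ((1 / 2) * ∑ i, u i ^ 2) - (v0 a - v0 b)
            + lam * ∑ i, |u (i + 1) - u i|) := by
          nlinarith [h]
        have := nonneg_of_mul_nonneg_right h3 ht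
        linarith
      refine le_of_forall_pos_le_add fun ε hε => ?_
      have hpos : 0 < (1 / 2) * ∑ i, u i ^ 2 + 1 := by positivity
      refine (hineq (ε / ((1 / 2) * ∑ i, u i ^ 2 + 1)) (by positivity)).trans ?_
      gcongr
      rw [div_mul_eq_mul_div, div_le_iff₀ hpos]
      nlinarith
    have hmem : normInf1 n (fun i => v0 i - (v0 a + v0 b) / 2) ∈ {r : ℝ | ∃ v : ZMod n → ℝ,
          div1 n v = (fun i => y i - mean1 n y) ∧ r = normInf1 n v} := by
      refine ⟨_, ?_, rfl⟩
      rw [← hv0]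
      funext i
      simp [div1]
    refine (csInf_le ⟨0, ?_⟩ hmem).trans ?_
    · rintro r ⟨v, -, rfl⟩
      exact (abs_nonneg (v 0)).trans
        (Finset.le_sup' (fun i => |v i|) (Finset.mem_univ (0 : ZMod n)))
    · refine Finset.sup'_le _ _ fun i _ => ?_
      rw [abs_le]
      constructor <;> linarith [ha i, hb i]
  · intro hle x
    obtain ⟨d, rfl⟩ : ∃ d : ZMod n → ℝ, x = fun i => mean1 n y + d i :=
      ⟨fun i => x i - mean1 n y, by funext i; ring⟩
    rw [obj1_expand n lam y d v0 hv0]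
    have hS : 0 ≤ ∑ i, d i ^ 2 := Finset.sum_nonneg fun i _ => sq_nonneg _
    have hT : 0 ≤ ∑ i, |d (i + 1) - d i| := Finset.sum_nonneg fun i _ => abs_nonneg _
    have hb : ∀ δ : ℝ, 0 < δ → ∑ i, v0 i * (d (i + 1) - d i)
        ≤ (lam + δ) * ∑ i, |d (i + 1) - d i| := by
      intro δ hδ
      obtain ⟨r, ⟨v, hv, rfl⟩, hr⟩ := exists_lt_of_csInf_lt
        (⟨_, v0, hv0, rfl⟩ : Set.Nonempty {r : ℝ | ∃ v : ZMod n → ℝ,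
          div1 n v = (fun i => y i - mean1 n y) ∧ r = normInf1 n v})
        (lt_of_le_of_lt hle (lt_add_of_pos_right lam hδ))
      rw [← sum_div1_mul, hv0, ← hv, sum_div1_mul, Finset.mul_sum]
      refine Finset.sum_le_sum fun i _ => ?_
      have hvi : |v i| ≤ lam + δ :=
        (Finset.le_sup' (fun i => |v i|) (Finset.mem_univ i)).trans hr.le
      calc v i * (d (i + 1) - d i) ≤ |v i * (d (i + 1) - d i)| := le_abs_self _
        _ = |v i| * |d (i + 1) - d i| := abs_mul _ _
        _ ≤ _ := mul_le_mul_of_nonneg_right hvi (abs_nonneg _)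
    have hfin : ∑ i, v0 i * (d (i + 1) - d i) ≤ lam * ∑ i, |d (i + 1) - d i| := by
      refine le_of_forall_pos_le_add fun ε hε => ?_
      have hpos : 0 < ∑ i, |d (i + 1) - d i| + 1 := by positivity
      refine (hb (ε / (∑ i, |d (i + 1) - d i| + 1)) (by positivity)).trans ?_
      rw [add_mul]
      gcongr
      rw [div_mul_eq_mul_div, div_le_iff₀ hpos]
      nlinarith
    linarith
end

section
/- Let n₁, n₂ ≥ 1, n = n₁n₂, y ∈ ℝ^{ZMod n₁ × ZMod n₂} and λ > 0. The constant image ȳ𝟙 is the minimizer of x ↦ (1/2)‖y − x‖₂² + λ‖∇x‖₁ over ℝ^{ZMod n₁ × ZMod n₂} if and only if there exists a pair of fields (v, w) with ‖(v, w)‖_∞ ≤ λ and div(v, w) = y − ȳ𝟙. -/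
/-- Discrete periodic divergence in 2D applied to a pair of fields `(v, w)`:
`(div (v, w))_{i,j} = v_{i-1,j} - v_{i,j} + w_{i,j-1} - w_{i,j}`. -/
noncomputable def div2 (n₁ n₂ : ℕ)
    (vw : (ZMod n₁ × ZMod n₂ → ℝ) × (ZMod n₁ × ZMod n₂ → ℝ)) :
    ZMod n₁ × ZMod n₂ → ℝ :=
  fun p => vw.1 (p.1 - 1, p.2) - vw.1 p + (vw.2 (p.1, p.2 - 1) - vw.2 p)

/-- Mean of an image indexed by `ZMod n₁ × ZMod n₂`. -/
noncomputable def mean2 (n₁ n₂ : ℕ) [NeZero n₁] [NeZero n₂]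
    (y : ZMod n₁ × ZMod n₂ → ℝ) : ℝ :=
  (∑ p, y p) / (n₁ * n₂)

/-- Sup norm of a pair of fields: maximum over all entries of `|v_{i,j}|`, `|w_{i,j}|`. -/
noncomputable def normInf2 (n₁ n₂ : ℕ) [NeZero n₁] [NeZero n₂]
    (vw : (ZMod n₁ × ZMod n₂ → ℝ) × (ZMod n₁ × ZMod n₂ → ℝ)) : ℝ :=
  max (Finset.univ.sup' Finset.univ_nonempty fun p => |vw.1 p|)
    (Finset.univ.sup' Finset.univ_nonempty fun p => |vw.2 p|)

/-- 2D TV-denoising objective: `(1/2)‖y - x‖₂² + λ‖∇x‖₁`. -/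
noncomputable def obj2 (n₁ n₂ : ℕ) [NeZero n₁] [NeZero n₂] (lam : ℝ)
    (y x : ZMod n₁ × ZMod n₂ → ℝ) : ℝ :=
  (1 / 2) * ∑ p, (y p - x p) ^ 2 +
    lam * ∑ p, (|x (p.1 + 1, p.2) - x p| + |x (p.1, p.2 + 1) - x p|)

theorem aux_adj (n₁ n₂ : ℕ) [NeZero n₁] [NeZero n₂]
    (v w u : ZMod n₁ × ZMod n₂ → ℝ) :
    ∑ p, div2 n₁ n₂ (v, w) p * u p =
      ∑ p, (v p * (u (p.1 + 1, p.2) - u p) + w p * (u (p.1, p.2 + 1) - u p)) := by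
  have h1 : ∑ p : ZMod n₁ × ZMod n₂, v (p.1 - 1, p.2) * u p
      = ∑ p : ZMod n₁ × ZMod n₂, v p * u (p.1 + 1, p.2) := by
    rw [← Equiv.sum_comp (Equiv.addRight ((1, 0) : ZMod n₁ × ZMod n₂))]
    apply Finset.sum_congr rfl
    rintro ⟨a, b⟩ _
    simp
  have h2 : ∑ p : ZMod n₁ × ZMod n₂, w (p.1, p.2 - 1) * u p
      = ∑ p : ZMod n₁ × ZMod n₂, w p * u (p.1, p.2 + 1) := by
    rw [← Equiv.sum_comp (Equiv.addRight ((0, 1) : ZMod n₁ × ZMod n₂))]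
    apply Finset.sum_congr rfl
    rintro ⟨a, b⟩ _
    simp
  simp only [div2, add_mul, sub_mul, mul_sub, Finset.sum_add_distrib, Finset.sum_sub_distrib]
  rw [h1, h2]

theorem aux_norm (n₁ n₂ : ℕ) [NeZero n₁] [NeZero n₂]
    (v w : ZMod n₁ × ZMod n₂ → ℝ) (lam : ℝ) :
    normInf2 n₁ n₂ (v, w) ≤ lam ↔ (∀ p, |v p| ≤ lam) ∧ (∀ p, |w p| ≤ lam) := by
  simp [normInf2, Finset.sup'_le_iff]

theorem aux_sep (n₁ n₂ : ℕ) [NeZero n₁] [NeZero n₂]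
    (z : ZMod n₁ × ZMod n₂ → ℝ) (lam : ℝ) (hlam : 0 < lam)
    (h : ∀ u : ZMod n₁ × ZMod n₂ → ℝ, ∑ p, z p * u p ≤
      lam * ∑ p, (|u (p.1 + 1, p.2) - u p| + |u (p.1, p.2 + 1) - u p|)) :
    ∃ vw : (ZMod n₁ × ZMod n₂ → ℝ) × (ZMod n₁ × ZMod n₂ → ℝ),
        normInf2 n₁ n₂ vw ≤ lam ∧ div2 n₁ n₂ vw = z := by
  by_contra hne
  let B : Set (ZMod n₁ × ZMod n₂ → ℝ) := Set.pi Set.univ fun _ => Set.Icc (-lam) lam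
  have hBc : IsCompact B := isCompact_univ_pi fun _ => isCompact_Icc
  have hBv : Convex ℝ B := convex_pi fun _ _ => convex_Icc _ _
  have hcont : Continuous (div2 n₁ n₂) := by
    unfold div2
    fun_prop
  have hlin : IsLinearMap ℝ (div2 n₁ n₂) := by
    constructor
    · intro a b
      ext p
      simp [div2]
      ring
    · intro c a
      ext p
      simp [div2]
      ring
  have hmem : ∀ v : ZMod n₁ × ZMod n₂ → ℝ, v ∈ B ↔ ∀ p, |v p| ≤ lam := by
    intro v
    simp only [B, Set.mem_univ_pi, Set.mem_Icc, abs_le]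
  have hz : z ∉ div2 n₁ n₂ '' (B ×ˢ B) := by
    rintro ⟨⟨v, w⟩, ⟨hv, hw⟩, rfl⟩
    exact hne ⟨(v, w), (aux_norm n₁ n₂ v w lam).2 ⟨(hmem v).1 hv, (hmem w).1 hw⟩, rfl⟩
  obtain ⟨f, s, hs, hsz⟩ := geometric_hahn_banach_closed_point
    ((hBv.prod hBv).is_linear_image hlin) ((hBc.prod hBc).image hcont).isClosed hz
  let u : ZMod n₁ × ZMod n₂ → ℝ := fun p => f (Pi.single p 1)
  have hf : ∀ x, f x = ∑ p, x p * u p := by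
    intro x
    have := LinearMap.pi_apply_eq_sum_univ (f : (ZMod n₁ × ZMod n₂ → ℝ) →ₗ[ℝ] ℝ) x
    simp only [ContinuousLinearMap.coe_coe, smul_eq_mul] at this
    rw [this]
    refine Finset.sum_congr rfl fun p _ => ?_
    congr 2
    ext q
    simp [Pi.single_apply, eq_comm]
  let sg : ℝ → ℝ := fun t => if 0 ≤ t then lam else -lam
  have hsg : ∀ t, sg t * t = lam * |t| := by
    intro t
    by_cases ht : 0 ≤ t
    · simp [sg, ht, abs_of_nonneg ht]
    · simp [sg, ht, abs_of_neg (not_le.1 ht)]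
  have hsgb : ∀ t, |sg t| ≤ lam := by
    intro t
    by_cases ht : 0 ≤ t <;> simp [sg, ht, abs_of_pos hlam]
  have key := hs _ ⟨(fun p => sg (u (p.1 + 1, p.2) - u p), fun p => sg (u (p.1, p.2 + 1) - u p)),
    ⟨(hmem _).2 fun p => hsgb _, (hmem _).2 fun p => hsgb _⟩, rfl⟩
  rw [hf, aux_adj] at key
  simp only [hsg, ← mul_add, ← Finset.mul_sum] at key
  rw [hf] at hsz
  have := h u
  linarith

theorem aux_obj (n₁ n₂ : ℕ) [NeZero n₁] [NeZero n₂] (lam m t : ℝ) (ht : 0 ≤ t)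
    (y u : ZMod n₁ × ZMod n₂ → ℝ) :
    obj2 n₁ n₂ lam y (fun p => m + t * u p) = obj2 n₁ n₂ lam y (fun _ => m)
      + t ^ 2 * ((1 / 2) * ∑ p, u p ^ 2) - t * ∑ p, (y p - m) * u p
      + t * (lam * ∑ p, (|u (p.1 + 1, p.2) - u p| + |u (p.1, p.2 + 1) - u p|)) := by
  have h1 : ∀ a b : ℝ, |m + t * a - (m + t * b)| = t * |a - b| := by
    intro a b
    rw [show m + t * a - (m + t * b) = t * (a - b) by ring, abs_mul, abs_of_nonneg ht]
  have h2 : ∀ p, (y p - (m + t * u p)) ^ 2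
      = (y p - m) ^ 2 + (t ^ 2 * u p ^ 2 - 2 * t * ((y p - m) * u p)) := by
    intro p
    ring
  simp only [obj2, h1, h2, ← mul_add, Finset.sum_add_distrib, Finset.sum_sub_distrib,
    ← Finset.mul_sum, sub_self, abs_zero, Finset.sum_const_zero]
  ring

theorem stmt2 (n₁ n₂ : ℕ) [NeZero n₁] [NeZero n₂] (hn₁ : 1 ≤ n₁) (hn₂ : 1 ≤ n₂)
    (y : ZMod n₁ × ZMod n₂ → ℝ) (lam : ℝ) (hlam : 0 < lam) :
    (∀ x : ZMod n₁ × ZMod n₂ → ℝ,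
        obj2 n₁ n₂ lam y (fun _ => mean2 n₁ n₂ y) ≤ obj2 n₁ n₂ lam y x) ↔
      ∃ vw : (ZMod n₁ × ZMod n₂ → ℝ) × (ZMod n₁ × ZMod n₂ → ℝ),
        normInf2 n₁ n₂ vw ≤ lam ∧
          div2 n₁ n₂ vw = fun p => y p - mean2 n₁ n₂ y := by
  generalize mean2 n₁ n₂ y = m
  constructor
  · intro h
    apply aux_sep n₁ n₂ _ lam hlam
    intro u
    by_contra hlt
    rw [not_le] at hlt
    set A := ∑ p, (y p - m) * u p with hA
    set T := lam * ∑ p, (|u (p.1 + 1, p.2) - u p| + |u (p.1, p.2 + 1) - u p|) with hT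
    set Q := (1 / 2) * ∑ p, u p ^ 2 with hQ
    have hQ0 : 0 ≤ Q := by positivity
    have ht : 0 < (A - T) / (Q + 1) := div_pos (by linarith) (by linarith)
    have h3 := h (fun p => m + (A - T) / (Q + 1) * u p)
    rw [aux_obj n₁ n₂ lam m _ ht.le, ← hA, ← hT, ← hQ] at h3
    have h4 : (A - T) / (Q + 1) * (Q + 1) = A - T := by field_simp
    set t := (A - T) / (Q + 1)
    nlinarith [mul_pos ht ht]
  · rintro ⟨⟨v, w⟩, hn, hd⟩ x
    rw [aux_norm] at hn
    have h3 := aux_obj n₁ n₂ lam m 1 zero_le_one y (fun p => x p - m)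
    have hx : (fun p => m + 1 * (x p - m)) = x := by
      ext p
      ring
    have h4 := aux_adj n₁ n₂ v w (fun p => x p - m)
    rw [hd] at h4
    rw [hx, h4] at h3
    have h5 : ∑ p : ZMod n₁ × ZMod n₂, (v p * ((x (p.1 + 1, p.2) - m) - (x p - m))
          + w p * ((x (p.1, p.2 + 1) - m) - (x p - m)))
        ≤ lam * ∑ p : ZMod n₁ × ZMod n₂, (|(x (p.1 + 1, p.2) - m) - (x p - m)|
          + |(x (p.1, p.2 + 1) - m) - (x p - m)|) := by
      rw [Finset.mul_sum]
      refine Finset.sum_le_sum fun p _ => ?_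
      rw [mul_add]
      have hb : ∀ a b : ℝ, |a| ≤ lam → a * b ≤ lam * |b| := fun a b hab =>
        (le_abs_self _).trans (by rw [abs_mul]; gcongr)
      exact add_le_add (hb _ _ (hn.1 p)) (hb _ _ (hn.2 p))
    have h6 : 0 ≤ ∑ p : ZMod n₁ × ZMod n₂, (x p - m) ^ 2 := by positivity
    linarith
end

section
/- Let n₁, n₂ ≥ 1, n = n₁n₂ and y ∈ ℝ^{ZMod n₁ × ZMod n₂}. Define λ_max = sInf {‖(v, w)‖_∞ : div(v, w) = y − ȳ𝟙}. Then for every λ > 0, the constant image ȳ𝟙 is the minimizer of x ↦ (1/2)‖y − x‖₂² + λ‖∇x‖₁ if and only if λ ≥ λ_max. -/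
noncomputable def gradL1 (n₁ n₂ : ℕ) [NeZero n₁] [NeZero n₂]
    (x : ZMod n₁ × ZMod n₂ → ℝ) : ℝ :=
  ∑ p, (|x (p.1 + 1, p.2) - x p| + |x (p.1, p.2 + 1) - x p|)

theorem div2_adj (n₁ n₂ : ℕ) [NeZero n₁] [NeZero n₂]
    (vw : (ZMod n₁ × ZMod n₂ → ℝ) × (ZMod n₁ × ZMod n₂ → ℝ)) (u : ZMod n₁ × ZMod n₂ → ℝ) :
    ∑ p, div2 n₁ n₂ vw p * u p =
      ∑ p : ZMod n₁ × ZMod n₂,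
        (vw.1 p * (u (p.1 + 1, p.2) - u p) + vw.2 p * (u (p.1, p.2 + 1) - u p)) := by
  have h1 : ∑ p : ZMod n₁ × ZMod n₂, vw.1 (p.1 - 1, p.2) * u p =
      ∑ p : ZMod n₁ × ZMod n₂, vw.1 p * u (p.1 + 1, p.2) := by
    refine Fintype.sum_equiv ((Equiv.subRight (1 : ZMod n₁)).prodCongr (Equiv.refl _)) _ _ ?_
    rintro ⟨a, b⟩
    simp
  have h2 : ∑ p : ZMod n₁ × ZMod n₂, vw.2 (p.1, p.2 - 1) * u p =
      ∑ p : ZMod n₁ × ZMod n₂, vw.2 p * u (p.1, p.2 + 1) := by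
    refine Fintype.sum_equiv ((Equiv.refl _).prodCongr (Equiv.subRight (1 : ZMod n₂))) _ _ ?_
    rintro ⟨a, b⟩
    simp
  simp only [div2, sub_mul, add_mul, mul_sub, Finset.sum_add_distrib, Finset.sum_sub_distrib,
    h1, h2]

noncomputable def div2L (n₁ n₂ : ℕ) :
    ((ZMod n₁ × ZMod n₂ → ℝ) × (ZMod n₁ × ZMod n₂ → ℝ)) →ₗ[ℝ] (ZMod n₁ × ZMod n₂ → ℝ) where
  toFun := div2 n₁ n₂
  map_add' a b := by
    funext p; simp [div2]; ring
  map_smul' c a := by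
    funext p; simp [div2]; ring

theorem functional_repr {ι : Type*} [Fintype ι] [DecidableEq ι] (f : (ι → ℝ) →ₗ[ℝ] ℝ) :
    ∃ u : ι → ℝ, ∀ g, f g = ∑ p, g p * u p := by
  refine ⟨fun p => f (fun j => if p = j then 1 else 0), fun g => ?_⟩
  simpa using f.pi_apply_eq_sum_univ g

theorem normInf2_le_iff (n₁ n₂ : ℕ) [NeZero n₁] [NeZero n₂]
    (vw : (ZMod n₁ × ZMod n₂ → ℝ) × (ZMod n₁ × ZMod n₂ → ℝ)) (r : ℝ) :
    normInf2 n₁ n₂ vw ≤ r ↔ (∀ p, |vw.1 p| ≤ r) ∧ (∀ p, |vw.2 p| ≤ r) := by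
  simp [normInf2]

theorem normInf2_nonneg (n₁ n₂ : ℕ) [NeZero n₁] [NeZero n₂]
    (vw : (ZMod n₁ × ZMod n₂ → ℝ) × (ZMod n₁ × ZMod n₂ → ℝ)) : 0 ≤ normInf2 n₁ n₂ vw :=
  (abs_nonneg _).trans (((normInf2_le_iff n₁ n₂ vw _).1 le_rfl).1 0)

theorem gradL1_nonneg (n₁ n₂ : ℕ) [NeZero n₁] [NeZero n₂]
    (u : ZMod n₁ × ZMod n₂ → ℝ) : 0 ≤ gradL1 n₁ n₂ u :=
  Finset.sum_nonneg fun _ _ => by positivity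

theorem dual_le (n₁ n₂ : ℕ) [NeZero n₁] [NeZero n₂]
    (vw : (ZMod n₁ × ZMod n₂ → ℝ) × (ZMod n₁ × ZMod n₂ → ℝ)) (u : ZMod n₁ × ZMod n₂ → ℝ) :
    ∑ p, div2 n₁ n₂ vw p * u p ≤ normInf2 n₁ n₂ vw * gradL1 n₁ n₂ u := by
  rw [div2_adj, gradL1, Finset.mul_sum]
  obtain ⟨h1, h2⟩ := (normInf2_le_iff n₁ n₂ vw _).1 le_rfl
  refine Finset.sum_le_sum fun p _ => ?_
  rw [mul_add]
  have aux : ∀ a b r : ℝ, |a| ≤ r → a * b ≤ r * |b| := fun a b r h =>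
    (le_abs_self _).trans (by rw [abs_mul]; exact mul_le_mul_of_nonneg_right h (abs_nonneg _))
  exact add_le_add (aux _ _ _ (h1 p)) (aux _ _ _ (h2 p))

theorem exists_of_bound (n₁ n₂ : ℕ) [NeZero n₁] [NeZero n₂] (lam : ℝ) (hl : 0 < lam)
    (z : ZMod n₁ × ZMod n₂ → ℝ)
    (h : ∀ u : ZMod n₁ × ZMod n₂ → ℝ, ∑ p, z p * u p ≤ lam * gradL1 n₁ n₂ u) :
    ∃ vw, div2 n₁ n₂ vw = z ∧ normInf2 n₁ n₂ vw ≤ lam := by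
  by_contra hne
  set K := (div2L n₁ n₂) '' (Metric.closedBall 0 lam) with hK
  have hz : z ∉ K := by
    rintro ⟨vw, hvw, rfl⟩
    refine hne ⟨vw, rfl, ?_⟩
    rw [mem_closedBall_zero_iff, Prod.norm_def, max_le_iff, pi_norm_le_iff_of_nonneg hl.le,
      pi_norm_le_iff_of_nonneg hl.le] at hvw
    exact (normInf2_le_iff n₁ n₂ vw _).2 hvw
  have hcont : Continuous (div2L n₁ n₂) := LinearMap.continuous_of_finiteDimensional _
  have hcomp : IsCompact K := (isCompact_closedBall _ _).image hcont
  have hconv : Convex ℝ K := (convex_closedBall _ _).linear_image _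
  obtain ⟨f, c, hf1, hf2⟩ := geometric_hahn_banach_closed_point hconv hcomp.isClosed hz
  obtain ⟨u, hu⟩ := functional_repr f.toLinearMap
  have hu' : ∀ g, f g = ∑ p, g p * u p := hu
  let vw : (ZMod n₁ × ZMod n₂ → ℝ) × (ZMod n₁ × ZMod n₂ → ℝ) :=
    (fun p => lam * (SignType.sign (u (p.1 + 1, p.2) - u p) : ℝ),
     fun p => lam * (SignType.sign (u (p.1, p.2 + 1) - u p) : ℝ))
  have hs : ∀ a : ℝ, |lam * (SignType.sign a : ℝ)| ≤ lam := by
    intro a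
    rw [abs_mul, abs_of_pos hl]
    rcases lt_trichotomy a 0 with h | h | h <;> simp [h, hl.le]
  have hmem : div2 n₁ n₂ vw ∈ K := by
    refine ⟨vw, ?_, rfl⟩
    rw [mem_closedBall_zero_iff, Prod.norm_def, max_le_iff, pi_norm_le_iff_of_nonneg hl.le,
      pi_norm_le_iff_of_nonneg hl.le]
    exact ⟨fun p => hs _, fun p => hs _⟩
  have h1 := hf1 _ hmem
  have h2 : f (div2 n₁ n₂ vw) = lam * gradL1 n₁ n₂ u := by
    rw [hu', div2_adj, gradL1, Finset.mul_sum]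
    refine Finset.sum_congr rfl fun p _ => ?_
    simp only [vw, mul_assoc, sign_mul_self, mul_add]
  have h3 := h u
  rw [← hu', ← h2] at h3
  linarith

theorem zmod_const {n : ℕ} [NeZero n] {α : Type*} (g : ZMod n → α) (h : ∀ a, g (a + 1) = g a)
    (a : ZMod n) : g a = g 0 := by
  have : ∀ k : ℕ, g (k : ZMod n) = g 0 := by
    intro k
    induction k with
    | zero => simp
    | succ k ih => rw [Nat.cast_succ, h, ih]
  rw [← ZMod.natCast_zmod_val a]
  exact this _

theorem exists_div (n₁ n₂ : ℕ) [NeZero n₁] [NeZero n₂] (z : ZMod n₁ × ZMod n₂ → ℝ)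
    (hz : ∑ p, z p = 0) : ∃ vw, div2 n₁ n₂ vw = z := by
  by_contra hne
  have hz' : z ∉ LinearMap.range (div2L n₁ n₂) := by
    rintro ⟨vw, h⟩
    exact hne ⟨vw, h⟩
  obtain ⟨f, hf1, hf2⟩ := Submodule.exists_le_ker_of_notMem hz'
  obtain ⟨u, hu⟩ := functional_repr f
  have hG : ∀ vw, ∑ p, div2 n₁ n₂ vw p * u p = 0 := fun vw => by
    rw [← hu]
    exact hf2 ⟨vw, rfl⟩
  have h0 : ∀ p : ZMod n₁ × ZMod n₂, (u (p.1 + 1, p.2) - u p) = 0 ∧ (u (p.1, p.2 + 1) - u p) = 0 := by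
    have := hG (fun p => u (p.1 + 1, p.2) - u p, fun p => u (p.1, p.2 + 1) - u p)
    rw [div2_adj, Finset.sum_eq_zero_iff_of_nonneg
      (fun p _ => add_nonneg (mul_self_nonneg _) (mul_self_nonneg _))] at this
    intro p
    have hp := this p (Finset.mem_univ _)
    exact ⟨by dsimp only at hp; nlinarith [mul_self_nonneg (u (p.1 + 1, p.2) - u p), mul_self_nonneg (u (p.1, p.2 + 1) - u p)],
      by dsimp only at hp; nlinarith [mul_self_nonneg (u (p.1 + 1, p.2) - u p), mul_self_nonneg (u (p.1, p.2 + 1) - u p)]⟩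
  have hc : ∀ p, u p = u (0, 0) := by
    rintro ⟨a, b⟩
    rw [zmod_const (fun a => u (a, b)) (fun a => sub_eq_zero.1 (h0 (a, b)).1) a]
    exact zmod_const (fun b => u (0, b)) (fun b => sub_eq_zero.1 (h0 (0, b)).2) b
  apply hf1
  rw [hu]
  simp only [hc]
  rw [← Finset.sum_mul, hz, zero_mul]

theorem obj2_add (n₁ n₂ : ℕ) [NeZero n₁] [NeZero n₂] (lam m : ℝ)
    (y u : ZMod n₁ × ZMod n₂ → ℝ) :
    obj2 n₁ n₂ lam y (fun p => m + u p) = obj2 n₁ n₂ lam y (fun _ => m)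
      + ((1 / 2) * ∑ p, u p ^ 2 + lam * gradL1 n₁ n₂ u - ∑ p, (y p - m) * u p) := by
  have : ∑ p, (y p - (m + u p)) ^ 2 =
      ∑ p, (y p - m) ^ 2 + ∑ p, u p ^ 2 - 2 * ∑ p, (y p - m) * u p := by
    rw [Finset.mul_sum, ← Finset.sum_add_distrib, ← Finset.sum_sub_distrib]
    exact Finset.sum_congr rfl fun p _ => by ring
  simp only [obj2, gradL1, this, add_sub_add_left_eq_sub, sub_self, abs_zero, add_zero,
    Finset.sum_const_zero]
  ring

theorem gradL1_smul (n₁ n₂ : ℕ) [NeZero n₁] [NeZero n₂] (t : ℝ) (ht : 0 < t)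
    (u : ZMod n₁ × ZMod n₂ → ℝ) :
    gradL1 n₁ n₂ (fun p => t * u p) = t * gradL1 n₁ n₂ u := by
  simp only [gradL1, ← mul_sub, abs_mul, abs_of_pos ht, ← mul_add, ← Finset.mul_sum]

theorem min_iff (n₁ n₂ : ℕ) [NeZero n₁] [NeZero n₂] (lam m : ℝ)
    (y : ZMod n₁ × ZMod n₂ → ℝ) :
    (∀ x, obj2 n₁ n₂ lam y (fun _ => m) ≤ obj2 n₁ n₂ lam y x) ↔
      ∀ u : ZMod n₁ × ZMod n₂ → ℝ, ∑ p, (y p - m) * u p ≤ lam * gradL1 n₁ n₂ u := by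
  constructor
  · intro h u
    by_contra! hc
    set c := ∑ p, (y p - m) * u p - lam * gradL1 n₁ n₂ u with hcdef
    have hc0 : 0 < c := by linarith
    set N := ∑ p, u p ^ 2 with hN
    have hN0 : 0 ≤ N := Finset.sum_nonneg fun _ _ => sq_nonneg _
    have key : ∀ t : ℝ, 0 < t → c ≤ t / 2 * N := by
      intro t ht
      have h1 := h (fun p => m + t * u p)
      rw [obj2_add n₁ n₂ lam m y (fun p => t * u p), gradL1_smul n₁ n₂ t ht] at h1
      have e1 : ∑ p, (t * u p) ^ 2 = t ^ 2 * N := by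
        rw [hN, Finset.mul_sum]; exact Finset.sum_congr rfl fun p _ => by ring
      have e2 : ∑ p, (y p - m) * (t * u p) = t * ∑ p, (y p - m) * u p := by
        rw [Finset.mul_sum]; exact Finset.sum_congr rfl fun p _ => by ring
      rw [e1, e2] at h1
      have : t * c ≤ t * (t / 2 * N) := by rw [hcdef]; linarith
      exact le_of_mul_le_mul_left this ht
    have := key (c / (N + 1)) (by positivity)
    have h2 : c / (N + 1) * (N + 1) = c := by field_simp
    have h3 : 0 < c / (N + 1) := by positivity
    nlinarith
  · intro h x
    have h1 := obj2_add n₁ n₂ lam m y (fun p => x p - m)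
    have h2 := h (fun p => x p - m)
    have h3 : 0 ≤ ∑ p, (x p - m) ^ 2 := Finset.sum_nonneg fun _ _ => sq_nonneg _
    simp only [add_sub_cancel] at h1
    change obj2 n₁ n₂ lam y x = _ at h1
    linarith

theorem stmt3 (n₁ n₂ : ℕ) [NeZero n₁] [NeZero n₂] (hn₁ : 1 ≤ n₁) (hn₂ : 1 ≤ n₂)
    (y : ZMod n₁ × ZMod n₂ → ℝ) :
    ∀ lam : ℝ, 0 < lam →
      ((∀ x : ZMod n₁ × ZMod n₂ → ℝ,
          obj2 n₁ n₂ lam y (fun _ => mean2 n₁ n₂ y) ≤ obj2 n₁ n₂ lam y x) ↔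
        sInf {r : ℝ | ∃ vw : (ZMod n₁ × ZMod n₂ → ℝ) × (ZMod n₁ × ZMod n₂ → ℝ),
          div2 n₁ n₂ vw = (fun p => y p - mean2 n₁ n₂ y) ∧
            r = normInf2 n₁ n₂ vw} ≤ lam) := by
  intro lam hl
  rw [min_iff]
  have hbdd : BddBelow {r : ℝ | ∃ vw : (ZMod n₁ × ZMod n₂ → ℝ) × (ZMod n₁ × ZMod n₂ → ℝ),
          div2 n₁ n₂ vw = (fun p => y p - mean2 n₁ n₂ y) ∧
            r = normInf2 n₁ n₂ vw} := by
    refine ⟨0, ?_⟩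
    rintro r ⟨vw, -, rfl⟩
    exact normInf2_nonneg n₁ n₂ vw
  constructor
  · intro h
    obtain ⟨vw, h1, h2⟩ := exists_of_bound n₁ n₂ lam hl _ h
    exact (csInf_le hbdd ⟨vw, h1, rfl⟩).trans h2
  · intro h u
    have hsum : ∑ p, (y p - mean2 n₁ n₂ y) = 0 := by
      have h1 : (n₁ : ℝ) ≠ 0 := by exact_mod_cast NeZero.ne n₁
      have h2 : (n₂ : ℝ) ≠ 0 := by exact_mod_cast NeZero.ne n₂
      rw [Finset.sum_sub_distrib]
      simp [mean2, Fintype.card_prod, ZMod.card]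
      field_simp
      simp
    obtain ⟨vw₀, h₀⟩ := exists_div n₁ n₂ _ hsum
    have hG := gradL1_nonneg n₁ n₂ u
    have hall : ∀ vw, div2 n₁ n₂ vw = (fun p => y p - mean2 n₁ n₂ y) →
        ∑ p, (y p - mean2 n₁ n₂ y) * u p ≤ normInf2 n₁ n₂ vw * gradL1 n₁ n₂ u := by
      intro vw hvw
      have := dual_le n₁ n₂ vw u
      rwa [hvw] at this
    rcases hG.eq_or_lt with hG0 | hGpos
    · have := hall vw₀ h₀
      rw [← hG0, mul_zero] at this ⊢
      exact this
    · rw [← div_le_iff₀ hGpos]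
      refine le_trans ?_ h
      refine le_csInf ⟨_, vw₀, h₀, rfl⟩ ?_
      rintro r ⟨vw, hvw, rfl⟩
      rw [div_le_iff₀ hGpos]
      exact hall vw hvw
end

section
/- Let n ≥ 1, y ∈ ℝ^{ZMod n}, and let M be the Moore–Penrose pseudoinverse of the one-dimensional discrete periodic divergence div. Then λ_max := sInf {‖v‖_∞ : div v = y − ȳ𝟙} satisfies λ_max = (max_i (M y)_i − min_i (M y)_i)/2. -/
/-- Discrete periodic divergence in 1D as a linear map: `(div v) i = v (i-1) - v i`. -/
noncomputable def div1L (n : ℕ) : (ZMod n → ℝ) →ₗ[ℝ] (ZMod n → ℝ) where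
  toFun v := fun i => v (i - 1) - v i
  map_add' a b := by funext i; simp only [Pi.add_apply]; ring
  map_smul' c a := by
    funext i
    simp only [Pi.smul_apply, smul_eq_mul, RingHom.id_apply]
    ring

/-- Standard inner product on `ZMod n → ℝ`. -/
noncomputable def dot1 (n : ℕ) [NeZero n] (u v : ZMod n → ℝ) : ℝ := ∑ i, u i * v i

theorem const_aux (n : ℕ) [NeZero n] (w : ZMod n → ℝ) (h : ∀ i, w (i - 1) = w i) (i : ZMod n) :
    w i = w 0 := by
  have key : ∀ k : ℕ, w (k : ZMod n) = w 0 := by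
    intro k
    induction k with
    | zero => simp
    | succ k ih =>
      rw [← ih, ← h]
      simp
  rw [← ZMod.natCast_zmod_val i]
  exact key _

theorem sum_shift_aux (n : ℕ) [NeZero n] (w : ZMod n → ℝ) : ∑ i, w (i - 1) = ∑ i, w i :=
  Equiv.sum_comp (Equiv.subRight (1 : ZMod n)) w

theorem proj_aux (n : ℕ) [NeZero n] (y : ZMod n → ℝ)
    (M : (ZMod n → ℝ) →ₗ[ℝ] (ZMod n → ℝ))
    (h1 : div1L n ∘ₗ M ∘ₗ div1L n = div1L n)
    (h3 : ∀ u v : ZMod n → ℝ, dot1 n (div1L n (M u)) v = dot1 n u (div1L n (M v))) :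
    div1L n (M y) = (fun i => y i - mean1 n y) := by
  set p := div1L n (M y) with hp
  set w : ZMod n → ℝ := fun i => y i - p i with hw
  have hort : ∑ i, w i * (w (i - 1) - w i) = 0 := by
    have e := h3 y (div1L n w)
    have e2 : div1L n (M (div1L n w)) = div1L n w := LinearMap.congr_fun h1 w
    rw [e2] at e
    have e3 : ∑ i, p i * (w (i - 1) - w i) = ∑ i, y i * (w (i - 1) - w i) := e
    calc ∑ i, w i * (w (i - 1) - w i)
        = ∑ i, (y i * (w (i - 1) - w i) - p i * (w (i - 1) - w i)) := by
          refine Finset.sum_congr rfl fun i _ => ?_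
          rw [← sub_mul]
      _ = 0 := by rw [Finset.sum_sub_distrib, e3, sub_self]
  have hsq : ∑ i, (w (i - 1) - w i) ^ 2 = 0 := by
    have s := sum_shift_aux n (fun i => w i ^ 2)
    have : ∀ i, (w (i - 1) - w i) ^ 2
        = w (i - 1) ^ 2 - w i ^ 2 - 2 * (w i * (w (i - 1) - w i)) := fun i => by ring
    simp only [this]
    rw [Finset.sum_sub_distrib, Finset.sum_sub_distrib, ← Finset.mul_sum, hort, s]
    ring
  have hc : ∀ i, w (i - 1) = w i := by
    intro i
    have := (Finset.sum_eq_zero_iff_of_nonneg (fun i _ => sq_nonneg (w (i - 1) - w i))).1 hsq i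
      (Finset.mem_univ i)
    exact sub_eq_zero.1 (pow_eq_zero_iff (two_ne_zero)|>.1 this)
  have hk := const_aux n w hc
  have hp0 : ∑ i, p i = 0 := by
    have : ∑ i, p i = ∑ i, (M y (i - 1) - M y i) := rfl
    rw [this, Finset.sum_sub_distrib, sum_shift_aux, sub_self]
  have hs : ∑ i, y i = n * w 0 := by
    have a : ∑ i, w i = ∑ i, y i - ∑ i, p i := Finset.sum_sub_distrib ..
    have b : ∑ i, w i = n * w 0 := by
      rw [Finset.sum_congr rfl fun i _ => hk i]
      simp [ZMod.card]
    linarith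
  have hm : mean1 n y = w 0 := by
    have : (n : ℝ) ≠ 0 := Nat.cast_ne_zero.2 (NeZero.ne n)
    rw [mean1, hs]
    field_simp
  funext i
  have a := hk i
  have b : w i = y i - p i := rfl
  rw [hm]
  linarith

theorem stmt11 (n : ℕ) [NeZero n] (hn : 1 ≤ n) (y : ZMod n → ℝ)
    (M : (ZMod n → ℝ) →ₗ[ℝ] (ZMod n → ℝ))
    (h1 : div1L n ∘ₗ M ∘ₗ div1L n = div1L n)
    (h2 : M ∘ₗ div1L n ∘ₗ M = M)
    (h3 : ∀ u v : ZMod n → ℝ, dot1 n (div1L n (M u)) v = dot1 n u (div1L n (M v)))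
    (h4 : ∀ u v : ZMod n → ℝ, dot1 n (M (div1L n u)) v = dot1 n u (M (div1L n v))) :
    sInf {r : ℝ | ∃ v : ZMod n → ℝ,
        div1L n v = (fun i => y i - mean1 n y) ∧ r = normInf1 n v} =
      ((Finset.univ.sup' Finset.univ_nonempty fun i => M y i) -
        (Finset.univ.inf' Finset.univ_nonempty fun i => M y i)) / 2 := by
  have hP := proj_aux n y M h1 h3
  set f : ZMod n → ℝ := fun i => M y i with hf
  set A := Finset.univ.sup' Finset.univ_nonempty f with hA
  set B := Finset.univ.inf' Finset.univ_nonempty f with hB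
  have hle : ∀ i, f i ≤ A := fun i => Finset.le_sup' f (Finset.mem_univ i)
  have hge : ∀ i, B ≤ f i := fun i => Finset.inf'_le f (Finset.mem_univ i)
  obtain ⟨a, -, ha⟩ := Finset.exists_mem_eq_sup' (Finset.univ_nonempty (α := ZMod n)) f
  obtain ⟨b, -, hb⟩ := Finset.exists_mem_eq_inf' (Finset.univ_nonempty (α := ZMod n)) f
  rw [← hA] at ha
  rw [← hB] at hb
  have low : ∀ v : ZMod n → ℝ, div1L n v = (fun i => y i - mean1 n y) →
      (A - B) / 2 ≤ normInf1 n v := by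
    intro v hv
    have hc : ∀ i, (v (i - 1) - f (i - 1)) = v i - f i := by
      intro i
      have e := congrFun (hv.trans hP.symm) i
      have e' : v (i - 1) - v i = f (i - 1) - f i := e
      linarith
    have hk := const_aux n (fun i => v i - f i) hc
    have k1 := hk a
    have k2 := hk b
    have l1 : |v a| ≤ normInf1 n v := Finset.le_sup' (fun i => |v i|) (Finset.mem_univ a)
    have l2 : |v b| ≤ normInf1 n v := Finset.le_sup' (fun i => |v i|) (Finset.mem_univ b)
    have := le_abs_self (v a)
    have := neg_abs_le (v b)
    linarith
  apply IsLeast.csInf_eq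
  constructor
  · have hv : div1L n (fun i => f i - (A + B) / 2) = (fun i => y i - mean1 n y) := by
      rw [← hP]
      funext i
      change (f (i - 1) - (A + B) / 2) - (f i - (A + B) / 2) = f (i - 1) - f i
      ring
    refine ⟨_, hv, le_antisymm (low _ hv) ?_⟩
    refine Finset.sup'_le _ _ fun i _ => ?_
    have := hle i
    have := hge i
    rw [abs_le]
    constructor <;> linarith
  · rintro r ⟨v, hv, rfl⟩
    exact low v hv
end

section
/- Let n ≥ 1 and let D be the matrix over ℂ indexed by ZMod n × ZMod n of the discrete periodic divergence, D_{i,j} = [j = i−1] − [j = i]. Let M be the Moore–Penrose pseudoinverse of D over ℂ. For k ∈ ZMod n let f_k ∈ ℂ^{ZMod n} be the Fourier vector (f_k)_j = exp(2πi jk / n). Then M f_0 = 0 and, for every k ≠ 0, M f_k = (exp(−2πik/n) − 1)⁻¹ · f_k. -/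
open Complex Matrix

/-- Matrix of the 1D discrete periodic divergence over `ℂ`:
`D i j = [j = i-1] - [j = i]`, so `(D v) i = v (i-1) - v i`. -/
noncomputable def divMat (n : ℕ) : Matrix (ZMod n) (ZMod n) ℂ :=
  Matrix.of fun i j => (if j = i - 1 then (1 : ℂ) else 0) - (if j = i then 1 else 0)

/-- Fourier vector: `(f k) j = exp (2πi jk / n)`. -/
noncomputable def fourierVec (n : ℕ) (k : ZMod n) : ZMod n → ℂ :=
  fun j => Complex.exp (2 * Real.pi * Complex.I * ((j.val : ℂ) * (k.val : ℂ)) / n)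

lemma fv_eq (n : ℕ) [NeZero n] (k j : ZMod n) :
    fourierVec n k j = ZMod.stdAddChar (j * k) := by
  have h : j * k = (((j.val * k.val : ℕ) : ℤ) : ZMod n) := by
    simp
  rw [h, ZMod.stdAddChar_coe]
  simp [fourierVec]

lemma ev_eq (n : ℕ) [NeZero n] (k : ZMod n) :
    Complex.exp (-(2 * Real.pi * Complex.I * (k.val : ℂ)) / n) = ZMod.stdAddChar (-k) := by
  have h : -k = ((-(k.val : ℤ) : ℤ) : ZMod n) := by
    simp
  rw [h, ZMod.stdAddChar_coe]
  simp

lemma D_fv (n : ℕ) [NeZero n] (k : ZMod n) :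
    (divMat n).mulVec (fourierVec n k) =
      ((ZMod.stdAddChar (-k) : ℂ) - 1) • fourierVec n k := by
  ext i
  simp only [Matrix.mulVec, dotProduct, divMat, Matrix.of_apply, sub_mul, ite_mul, one_mul,
    zero_mul, Finset.sum_sub_distrib, Finset.sum_ite_eq', Finset.sum_ite_eq, Finset.mem_univ,
    if_true, fv_eq, Pi.smul_apply, smul_eq_mul]
  rw [← AddChar.map_add_eq_mul]
  congr 2
  ring

lemma DH_fv (n : ℕ) [NeZero n] (k : ZMod n) :
    (divMat n)ᴴ.mulVec (fourierVec n k) =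
      ((ZMod.stdAddChar k : ℂ) - 1) • fourierVec n k := by
  ext i
  have h : ∀ x : ZMod n, (i = x - 1) = (x = i + 1) := by
    intro x
    rw [eq_sub_iff_add_eq]; exact propext eq_comm
  have h' : ∀ x : ZMod n, (i = x) = (x = i) := fun x => propext eq_comm
  simp only [Matrix.mulVec, dotProduct, divMat, Matrix.conjTranspose_apply, Matrix.of_apply, h, h',
    star_sub, apply_ite (star : ℂ → ℂ), star_one, star_zero, sub_mul, ite_mul, one_mul,
    zero_mul, Finset.sum_sub_distrib, Finset.sum_ite_eq', Finset.sum_ite_eq, Finset.mem_univ,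
    if_true, fv_eq, Pi.smul_apply, smul_eq_mul]
  rw [← AddChar.map_add_eq_mul]
  congr 2
  ring

lemma char_ne (n : ℕ) [NeZero n] (k : ZMod n) (hk : k ≠ 0) :
    (ZMod.stdAddChar k : ℂ) - 1 ≠ 0 := by
  intro h
  apply hk
  apply ZMod.injective_stdAddChar
  rw [AddChar.map_zero_eq_one]
  exact sub_eq_zero.mp h

theorem stmt14 (n : ℕ) [NeZero n] (hn : 1 ≤ n)
    (M : Matrix (ZMod n) (ZMod n) ℂ)
    (h1 : divMat n * M * divMat n = divMat n)
    (h2 : M * divMat n * M = M)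
    (h3 : (divMat n * M)ᴴ = divMat n * M)
    (h4 : (M * divMat n)ᴴ = M * divMat n) :
    M.mulVec (fourierVec n 0) = 0 ∧
      ∀ k : ZMod n, k ≠ 0 →
        M.mulVec (fourierVec n k) =
          (Complex.exp (-(2 * Real.pi * Complex.I * (k.val : ℂ)) / n) - 1)⁻¹ •
            fourierVec n k := by
  constructor
  · have h : M = M * Mᴴ * (divMat n)ᴴ := by
      rw [Matrix.mul_assoc, ← Matrix.conjTranspose_mul, h3, ← Matrix.mul_assoc, h2]
    rw [h, ← Matrix.mulVec_mulVec, DH_fv]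
    simp
  · intro k hk
    rw [ev_eq]
    have hl := char_ne n (-k) (neg_ne_zero.mpr hk)
    have hm := char_ne n k hk
    have hD := D_fv n k
    have hH := DH_fv n k
    have e : M * divMat n * (divMat n)ᴴ = (divMat n)ᴴ := by
      conv_lhs => rw [← h4, ← Matrix.conjTranspose_mul, ← Matrix.mul_assoc, h1]
    have hf : (M * divMat n).mulVec (fourierVec n k) = fourierVec n k := by
      have := congrArg (fun A => A.mulVec (fourierVec n k)) e
      simp only [← Matrix.mulVec_mulVec] at this
      rw [hH, Matrix.mulVec_smul, Matrix.mulVec_smul] at this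
      rw [← Matrix.mulVec_mulVec]
      exact smul_right_injective _ hm this
    rw [← Matrix.mulVec_mulVec, hD, Matrix.mulVec_smul] at hf
    rw [eq_inv_smul_iff₀ hl, hf]
end

section
/- Let n₁, n₂ ≥ 1, n = n₁n₂ and y an image over ZMod n₁ × ZMod n₂. The infimum λ_max = sInf {‖(v, w)‖_∞ : div(v, w) = y − ȳ𝟙} is attained: there exists a pair of fields (v, w) with div(v, w) = y − ȳ𝟙 and ‖(v, w)‖_∞ = λ_max. -/
lemma aux1 (n : ℕ) [NeZero n] (f : ZMod n → ℝ) (hf : ∑ i, f i = 0) :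
    ∃ v : ZMod n → ℝ, ∀ i, v (i - 1) - v i = f i := by
  have hsum : ∑ k ∈ Finset.range n, f (k : ZMod n) = 0 := by
    rw [← hf]
    refine Finset.sum_bij' (fun k _ => (k : ZMod n)) (fun i _ => i.val) ?_ ?_ ?_ ?_ ?_
    · simp
    · intro i _
      simpa using ZMod.val_lt i
    · intro k hk
      exact ZMod.val_cast_of_lt (by simpa using hk)
    · intro i _
      simp
    · intro k _
      rfl
  have key : ∀ i : ZMod n, ∑ k ∈ Finset.range (i + 1).val, f (k : ZMod n)
      = ∑ k ∈ Finset.range i.val, f (k : ZMod n) + f i := by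
    intro i
    have h1 : ∑ k ∈ Finset.range (i.val + 1), f (k : ZMod n)
      = ∑ k ∈ Finset.range i.val, f (k : ZMod n) + f i := by
      rw [Finset.sum_range_succ]; simp
    rw [← h1]
    have h2 : (i + 1).val = (i.val + 1) % n := by
      rw [← ZMod.val_natCast]; simp
    rw [h2]
    rcases Nat.lt_or_ge (i.val + 1) n with h | h
    · rw [Nat.mod_eq_of_lt h]
    · have h3 : i.val + 1 = n := le_antisymm (ZMod.val_lt i) h
      rw [h3, hsum]; simp
  refine ⟨fun i => -∑ k ∈ Finset.range (i + 1).val, f (k : ZMod n), fun i => ?_⟩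
  have := key i
  simp only [sub_add_cancel]
  linarith

lemma aux2 (n₁ n₂ : ℕ) [NeZero n₁] [NeZero n₂] (g : ZMod n₁ × ZMod n₂ → ℝ)
    (hg : ∑ p, g p = 0) : ∃ vw, div2 n₁ n₂ vw = g := by
  have hn : (n₁ : ℝ) ≠ 0 := by exact_mod_cast NeZero.ne n₁
  have hA : ∀ j, ∃ v : ZMod n₁ → ℝ, ∀ i, v (i - 1) - v i
      = g (i, j) - (∑ k, g (k, j)) / n₁ := by
    intro j
    apply aux1
    rw [Finset.sum_sub_distrib]
    simp
    field_simp
    simp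
  choose V hV using hA
  obtain ⟨W, hW⟩ := aux1 n₂ (fun j => (∑ k, g (k, j)) / n₁) (by
    rw [← Finset.sum_div, Finset.sum_comm, ← Fintype.sum_prod_type, hg, zero_div])
  refine ⟨(fun p => V p.2 p.1, fun p => W p.2), ?_⟩
  funext ⟨i, j⟩
  simp only [div2, hV, hW]
  ring

lemma aux3 (n₁ n₂ : ℕ) [NeZero n₁] [NeZero n₂]
    (vw : (ZMod n₁ × ZMod n₂ → ℝ) × (ZMod n₁ × ZMod n₂ → ℝ)) :
    normInf2 n₁ n₂ vw = ‖vw‖ := by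
  have h : ∀ v : ZMod n₁ × ZMod n₂ → ℝ,
      (Finset.univ.sup' Finset.univ_nonempty fun p => |v p|) = ‖v‖ := by
    intro v
    apply le_antisymm
    · exact Finset.sup'_le _ _ fun p _ => norm_le_pi_norm v p
    · rw [pi_norm_le_iff_of_nonempty]
      intro p
      exact Finset.le_sup' (fun p => |v p|) (Finset.mem_univ p)
  rw [normInf2, h, h, Prod.norm_def]

theorem stmt18 (n₁ n₂ : ℕ) [NeZero n₁] [NeZero n₂] (hn₁ : 1 ≤ n₁) (hn₂ : 1 ≤ n₂)
    (y : ZMod n₁ × ZMod n₂ → ℝ) :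
    ∃ vw : (ZMod n₁ × ZMod n₂ → ℝ) × (ZMod n₁ × ZMod n₂ → ℝ),
      div2 n₁ n₂ vw = (fun p => y p - mean2 n₁ n₂ y) ∧
        normInf2 n₁ n₂ vw =
          sInf {r : ℝ | ∃ ab : (ZMod n₁ × ZMod n₂ → ℝ) × (ZMod n₁ × ZMod n₂ → ℝ),
            div2 n₁ n₂ ab = (fun p => y p - mean2 n₁ n₂ y) ∧ r = normInf2 n₁ n₂ ab} := by
  set g : ZMod n₁ × ZMod n₂ → ℝ := fun p => y p - mean2 n₁ n₂ y with hgdef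
  have hg : ∑ p, g p = 0 := by
    have h1 : (n₁ : ℝ) ≠ 0 := by exact_mod_cast NeZero.ne n₁
    have h2 : (n₂ : ℝ) ≠ 0 := by exact_mod_cast NeZero.ne n₂
    rw [hgdef, Finset.sum_sub_distrib]
    simp [mean2]
    field_simp
    simp
  have hne : {vw | div2 n₁ n₂ vw = g}.Nonempty := aux2 n₁ n₂ g hg
  have hcl : IsClosed {vw | div2 n₁ n₂ vw = g} := by
    apply isClosed_eq _ continuous_const
    unfold div2
    fun_prop
  obtain ⟨vw, hvw, hd⟩ := hcl.exists_infDist_eq_dist hne 0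
  refine ⟨vw, hvw, ?_⟩
  symm
  apply IsLeast.csInf_eq
  refine ⟨⟨vw, hvw, rfl⟩, ?_⟩
  rintro r ⟨ab, hab, rfl⟩
  rw [aux3, aux3, ← dist_zero_left, ← dist_zero_left, ← hd]
  exact Metric.infDist_le_dist_of_mem hab
end
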